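/- arXiv:math/0611385 — 6 statements merged into one kernel-verified Lean document; each statement's English description precedes it below -/
import Mathlib

section
/- Let T = (T_{lk}) be an orthoscalar matrix representation of a separated single quiver with blocks T_{lk} of size d_l × e_k. Let A_l (size d_l × d_l) and B_k (size e_k × e_k) be invertible complex matrices satisfying A_l·T_{lk} = T_{lk}·B_k for all l, k. Write polar decompositions A_l = X_l·U_l and B_k = V_k·Y_k, where U_l, V_k are unitary and X_l, Y_k are positive-definite Hermitian. Then U_l·T_{lk} = T_{lk}·V_k for all l, k. -/
open Matrix
open scoped ComplexOrder

theorem Matrix.PosDef.eq_zero_of_trace_conjTranspose_mul_mul_eq_zero {p q : Type*}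
    [Fintype p] [Fintype q] {X : Matrix p p ℂ} (hX : X.PosDef) {D : Matrix p q ℂ}
    (h : (Dᴴ * X * D).trace = 0) : D = 0 := by
  classical
  have h0 : Dᴴ * X * D = 0 :=
    (hX.posSemidef.conjTranspose_mul_mul_same D).trace_eq_zero_iff.1 h
  refine ext_of_mulVec_single fun i => ?_
  by_contra hne
  rw [zero_mulVec] at hne
  have hpos := hX.dotProduct_mulVec_pos hne
  rw [star_mulVec, dotProduct_mulVec, vecMul_vecMul, ← dotProduct_mulVec, mulVec_mulVec, h0]
    at hpos
  simp at hpos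

theorem Matrix.trace_sub_conj_add_trace_sub_conj {p q : Type*} [Fintype p] [Fintype q]
    {X : Matrix p p ℂ} {Y : Matrix q q ℂ} {T Z : Matrix p q ℂ}
    (hX : X.IsHermitian) (hY : Y.IsHermitian) (h : X * Z = T * Y) :
    ((Z - T)ᴴ * X * (Z - T)).trace + ((Z - T) * Y * (Z - T)ᴴ).trace =
      ((X * (T * Tᴴ)).trace - (X * (Z * Zᴴ)).trace) +
        ((Y * (Zᴴ * Z)).trace - (Y * (Tᴴ * T)).trace) := by
  have h' : Zᴴ * X = Y * Tᴴ := by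
    simpa only [conjTranspose_mul, hX.eq, hY.eq] using congrArg conjTranspose h
  have e1 : (Zᴴ * X * Z).trace = (X * (Z * Zᴴ)).trace := by
    rw [Matrix.mul_assoc, trace_mul_comm, Matrix.mul_assoc]
  have e2 : (Tᴴ * X * T).trace = (X * (T * Tᴴ)).trace := by
    rw [Matrix.mul_assoc, trace_mul_comm, Matrix.mul_assoc]
  have e3 : (Zᴴ * X * T).trace = (Y * (Tᴴ * T)).trace := by
    rw [h', Matrix.mul_assoc]
  have e4 : (Tᴴ * X * Z).trace = (Y * (Tᴴ * T)).trace := by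
    rw [Matrix.mul_assoc, h, ← Matrix.mul_assoc, trace_mul_comm]
  have f1 : (Z * Y * Zᴴ).trace = (Y * (Zᴴ * Z)).trace := by
    rw [Matrix.mul_assoc, trace_mul_comm, Matrix.mul_assoc]
  have f2 : (T * Y * Tᴴ).trace = (Y * (Tᴴ * T)).trace := by
    rw [Matrix.mul_assoc, trace_mul_comm, Matrix.mul_assoc]
  have f3 : (T * Y * Zᴴ).trace = (X * (Z * Zᴴ)).trace := by
    rw [← h, Matrix.mul_assoc]
  have f4 : (Z * Y * Tᴴ).trace = (X * (Z * Zᴴ)).trace := by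
    rw [Matrix.mul_assoc, ← h', ← Matrix.mul_assoc, trace_mul_comm]
  simp only [conjTranspose_sub, Matrix.sub_mul, Matrix.mul_sub, trace_sub, e1, e2, e3, e4,
    f1, f2, f3, f4]
  ring

/-- Two families of matrices with the same row and column Gram sums that are intertwined by
positive definite matrices are equal. -/
theorem Matrix.eq_of_posDef_intertwine {ι κ : Type*} [Fintype ι] [Fintype κ]
    {p : ι → Type*} {q : κ → Type*} [∀ l, Fintype (p l)] [∀ k, Fintype (q k)]
    {T Z : ∀ l k, Matrix (p l) (q k) ℂ}
    {X : ∀ l, Matrix (p l) (p l) ℂ} {Y : ∀ k, Matrix (q k) (q k) ℂ}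
    (hX : ∀ l, (X l).PosDef) (hY : ∀ k, (Y k).PosDef)
    (hrow : ∀ l, ∑ k, Z l k * (Z l k)ᴴ = ∑ k, T l k * (T l k)ᴴ)
    (hcol : ∀ k, ∑ l, (Z l k)ᴴ * Z l k = ∑ l, (T l k)ᴴ * T l k)
    (h : ∀ l k, X l * Z l k = T l k * Y k) (l : ι) (k : κ) : Z l k = T l k := by
  have hnX (l k) : 0 ≤ ((Z l k - T l k)ᴴ * X l * (Z l k - T l k)).trace :=
    ((hX l).posSemidef.conjTranspose_mul_mul_same _).trace_nonneg
  have hnY (l k) : 0 ≤ ((Z l k - T l k) * Y k * (Z l k - T l k)ᴴ).trace :=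
    ((hY k).posSemidef.mul_mul_conjTranspose_same _).trace_nonneg
  have hrow' : ∑ l, ∑ k, ((X l * (T l k * (T l k)ᴴ)).trace -
      (X l * (Z l k * (Z l k)ᴴ)).trace) = 0 := by
    refine Finset.sum_eq_zero fun l _ => ?_
    rw [Finset.sum_sub_distrib, ← trace_sum, ← trace_sum, ← Matrix.mul_sum, ← Matrix.mul_sum,
      hrow, sub_self]
  have hcol' : ∑ l, ∑ k, ((Y k * ((Z l k)ᴴ * Z l k)).trace -
      (Y k * ((T l k)ᴴ * T l k)).trace) = 0 := by
    rw [Finset.sum_comm]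
    refine Finset.sum_eq_zero fun k _ => ?_
    rw [Finset.sum_sub_distrib, ← trace_sum, ← trace_sum, ← Matrix.mul_sum, ← Matrix.mul_sum,
      hcol, sub_self]
  have hsum : ∑ l, ∑ k, (((Z l k - T l k)ᴴ * X l * (Z l k - T l k)).trace +
      ((Z l k - T l k) * Y k * (Z l k - T l k)ᴴ).trace) = 0 := by
    simp_rw [fun l k => trace_sub_conj_add_trace_sub_conj (hX l).1 (hY k).1 (h l k),
      Finset.sum_add_distrib, hrow', hcol', add_zero]
  have hl := (Finset.sum_eq_zero_iff_of_nonneg fun l _ => Finset.sum_nonneg fun k _ =>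
    add_nonneg (hnX l k) (hnY l k)).1 hsum l (Finset.mem_univ l)
  have hlk := (Finset.sum_eq_zero_iff_of_nonneg fun k _ =>
    add_nonneg (hnX l k) (hnY l k)).1 hl k (Finset.mem_univ k)
  exact sub_eq_zero.1 ((hX l).eq_zero_of_trace_conjTranspose_mul_mul_eq_zero
    ((add_eq_zero_iff_of_nonneg (hnX l k) (hnY l k)).1 hlk).1)

/-- If `(A_l), (B_k)` is an invertible endomorphism of an orthoscalar matrix
representation `T` of a separated single quiver, with polar decompositions
`A_l = X_l U_l`, `B_k = V_k Y_k` (`U_l, V_k` unitary, `X_l, Y_k` positive definite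
Hermitian), then the unitary parts also intertwine `T`: `U_l T_{lk} = T_{lk} V_k`. -/
theorem stmt3 (m n : ℕ) (hm : 0 < m) (hn : 0 < n)
    (d : Fin m → ℕ) (e : Fin n → ℕ)
    (hd : ∀ l, 0 < d l) (he : ∀ k, 0 < e k)
    (T : ∀ (l : Fin m) (k : Fin n), Matrix (Fin (d l)) (Fin (e k)) ℂ)
    (χ : Fin m → ℝ) (χ' : Fin n → ℝ)
    (hχ : ∀ l, 0 < χ l) (hχ' : ∀ k, 0 < χ' k)
    (hrow : ∀ l, ∑ k, T l k * (T l k)ᴴ = (χ l : ℂ) • (1 : Matrix (Fin (d l)) (Fin (d l)) ℂ))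
    (hcol : ∀ k, ∑ l, (T l k)ᴴ * T l k = (χ' k : ℂ) • (1 : Matrix (Fin (e k)) (Fin (e k)) ℂ))
    (A X U : ∀ l : Fin m, Matrix (Fin (d l)) (Fin (d l)) ℂ)
    (B V Y : ∀ k : Fin n, Matrix (Fin (e k)) (Fin (e k)) ℂ)
    (hAinv : ∀ l, IsUnit (A l)) (hBinv : ∀ k, IsUnit (B k))
    (hintw : ∀ l k, A l * T l k = T l k * B k)
    (hpolA : ∀ l, A l = X l * U l) (hpolB : ∀ k, B k = V k * Y k)
    (hU : ∀ l, U l ∈ Matrix.unitaryGroup (Fin (d l)) ℂ)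
    (hV : ∀ k, V k ∈ Matrix.unitaryGroup (Fin (e k)) ℂ)
    (hX : ∀ l, (X l).PosDef) (hY : ∀ k, (Y k).PosDef) :
    ∀ l k, U l * T l k = T l k * V k := by
  have hUr (l) : U l * (U l)ᴴ = 1 := mem_unitaryGroup_iff.1 (hU l)
  have hVl (k) : (V k)ᴴ * V k = 1 := mem_unitaryGroup_iff'.1 (hV k)
  have hVr (k) : V k * (V k)ᴴ = 1 := mem_unitaryGroup_iff.1 (hV k)
  have hUl (l) : (U l)ᴴ * U l = 1 := mem_unitaryGroup_iff'.1 (hU l)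
  have hY' (k) : (V k * Y k * (V k)ᴴ).PosDef := by
    refine (hY k).mul_mul_conjTranspose_same fun x y hxy => ?_
    simpa [vecMul_vecMul, hVr] using congrArg (fun z => z ᵥ* (V k)ᴴ) hxy
  have key := eq_of_posDef_intertwine (T := T) (Z := fun l k => U l * T l k * (V k)ᴴ) hX hY'
    (fun l => ?_) (fun k => ?_) (fun l k => ?_)
  · intro l k
    calc U l * T l k = U l * T l k * (V k)ᴴ * V k := by
          rw [Matrix.mul_assoc _ _ (V k), hVl, Matrix.mul_one]
      _ = T l k * V k := by rw [key l k]
  · have hterm (k) : U l * T l k * (V k)ᴴ * (U l * T l k * (V k)ᴴ)ᴴ =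
        U l * (T l k * (T l k)ᴴ) * (U l)ᴴ := by
      simp only [conjTranspose_mul, conjTranspose_conjTranspose, Matrix.mul_assoc]
      rw [← Matrix.mul_assoc (V k)ᴴ (V k), hVl, Matrix.one_mul]
    simp_rw [hterm]
    rw [← Matrix.sum_mul, ← Matrix.mul_sum, hrow]
    simp [hUr]
  · have hterm (l) : (U l * T l k * (V k)ᴴ)ᴴ * (U l * T l k * (V k)ᴴ) =
        V k * ((T l k)ᴴ * T l k) * (V k)ᴴ := by
      simp only [conjTranspose_mul, conjTranspose_conjTranspose, Matrix.mul_assoc]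
      rw [← Matrix.mul_assoc (U l)ᴴ (U l), hUl, Matrix.one_mul]
    simp_rw [hterm]
    rw [← Matrix.sum_mul, ← Matrix.mul_sum, hcol]
    simp [hVr]
  · have hi := hintw l k
    rw [hpolA, hpolB] at hi
    rw [← Matrix.mul_assoc, ← Matrix.mul_assoc, hi, Matrix.mul_assoc]
end

section
/- Let T = (T_{lk}) be a family of complex matrices, where T_{lk} has size d_l × e_k for l = 1,…,m and k = 1,…,n. Suppose that whenever (E_1,…,E_m; F_1,…,F_n) is a family of orthogonal projections (self-adjoint idempotent complex matrices, E_l of size d_l, F_k of size e_k) satisfying E_l·T_{lk} = T_{lk}·F_k and F_k·T_{lk}* = T_{lk}*·E_l for all l, k, then either all E_l = 0 and all F_k = 0, or all E_l = I and all F_k = I. Then every family (A_1,…,A_m; B_1,…,B_n) of complex matrices (A_l of size d_l, B_k of size e_k) satisfying A_l·T_{lk} = T_{lk}·B_k and B_k·T_{lk}* = T_{lk}*·A_l for all l, k is scalar: there exists λ ∈ ℂ with A_l = λ·I for all l and B_k = λ·I for all k. -/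
open Matrix

/-- Real polynomials in square matrices respect the intertwining relation `A * T = T * B`. -/
theorem aeval_mul_eq_mul_aeval {a b : ℕ} {A : Matrix (Fin a) (Fin a) ℂ}
    {B : Matrix (Fin b) (Fin b) ℂ} {T : Matrix (Fin a) (Fin b) ℂ} (h : A * T = T * B)
    (p : Polynomial ℝ) : Polynomial.aeval A p * T = T * Polynomial.aeval B p := by
  induction p using Polynomial.induction_on' with
  | add p q hp hq => simp only [map_add, Matrix.add_mul, Matrix.mul_add, hp, hq]
  | monomial i r =>
    have hpow : A ^ i * T = T * B ^ i := by
      induction i with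
      | zero => simp
      | succ i ih => rw [pow_succ, Matrix.mul_assoc, h, ← Matrix.mul_assoc, ih,
          Matrix.mul_assoc, ← pow_succ]
    simp only [Polynomial.aeval_monomial, Algebra.algebraMap_eq_smul_one, smul_mul_assoc,
      one_mul, Matrix.smul_mul, Matrix.mul_smul, hpow]

theorem continuousOn_real_spectrum {a : ℕ} (A : Matrix (Fin a) (Fin a) ℂ) (f : ℝ → ℝ) :
    ContinuousOn f (spectrum ℝ A) :=
  A.finite_real_spectrum.continuousOn f

/-- The functional calculus of self-adjoint matrices respects the intertwining relation
`A * T = T * B`. -/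
theorem cfc_mul_eq_mul_cfc {a b : ℕ} {A : Matrix (Fin a) (Fin a) ℂ}
    {B : Matrix (Fin b) (Fin b) ℂ} {T : Matrix (Fin a) (Fin b) ℂ}
    (hA : IsSelfAdjoint A) (hB : IsSelfAdjoint B) (h : A * T = T * B) (f : ℝ → ℝ) :
    cfc f A * T = T * cfc f B := by
  classical
  let s : Finset ℝ := (A.finite_real_spectrum.union B.finite_real_spectrum).toFinset
  let p : Polynomial ℝ := Lagrange.interpolate s id f
  have hp : ∀ x ∈ spectrum ℝ A ∪ spectrum ℝ B, f x = p.eval x := fun x hx =>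
    (Lagrange.eval_interpolate_at_node f (Set.injOn_id _)
      ((Set.Finite.mem_toFinset _).2 hx)).symm
  have hfA : cfc f A = Polynomial.aeval A p := by
    rw [← cfc_polynomial p A hA]
    exact cfc_congr fun x hx => hp x (Or.inl hx)
  have hfB : cfc f B = Polynomial.aeval B p := by
    rw [← cfc_polynomial p B hB]
    exact cfc_congr fun x hx => hp x (Or.inr hx)
  rw [hfA, hfB, aeval_mul_eq_mul_aeval h]

/-- The spectral projection of a self-adjoint matrix at a spectral value is nonzero. -/
theorem cfc_indicator_ne_zero {a : ℕ} {A : Matrix (Fin a) (Fin a) ℂ} (hA : IsSelfAdjoint A)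
    {μ : ℝ} (hμ : μ ∈ spectrum ℝ A) : cfc (Set.indicator {μ} (1 : ℝ → ℝ)) A ≠ 0 := by
  intro h0
  have h1 := cfc_map_spectrum (Set.indicator {μ} (1 : ℝ → ℝ)) A hA
    (continuousOn_real_spectrum A _)
  have h2 : (1 : ℝ) ∈ spectrum ℝ (0 : Matrix (Fin a) (Fin a) ℂ) := by
    rw [← h0, h1]
    exact ⟨μ, hμ, by simp⟩
  rw [spectrum.mem_iff] at h2
  simp at h2

theorem cfc_indicator_mul_self {a : ℕ} (A : Matrix (Fin a) (Fin a) ℂ) (μ : ℝ) :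
    cfc (Set.indicator {μ} (1 : ℝ → ℝ)) A * cfc (Set.indicator {μ} (1 : ℝ → ℝ)) A =
      cfc (Set.indicator {μ} (1 : ℝ → ℝ)) A := by
  rw [← cfc_mul _ _ A (continuousOn_real_spectrum A _) (continuousOn_real_spectrum A _)]
  refine cfc_congr fun x _ => ?_
  by_cases hx : x = μ <;> simp [hx]

/-- A self-adjoint matrix whose spectral projection at `μ` is the identity is `μ • 1`. -/
theorem eq_smul_one_of_cfc_indicator_eq_one {a : ℕ} {A : Matrix (Fin a) (Fin a) ℂ}
    (hA : IsSelfAdjoint A) {μ : ℝ} (h : cfc (Set.indicator {μ} (1 : ℝ → ℝ)) A = 1) :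
    A = (μ : ℂ) • 1 := by
  have h1 : A * cfc (Set.indicator {μ} (1 : ℝ → ℝ)) A =
      μ • cfc (Set.indicator {μ} (1 : ℝ → ℝ)) A := by
    conv_lhs => enter [1]; rw [← cfc_id ℝ A hA]
    rw [← cfc_mul _ _ A (continuousOn_real_spectrum A _) (continuousOn_real_spectrum A _),
      ← cfc_smul μ _ A (continuousOn_real_spectrum A _)]
    refine cfc_congr fun x _ => ?_
    by_cases hx : x = μ <;> simp [hx]
  rw [h, mul_one] at h1
  rw [h1]
  ext i j
  simp

theorem eq_zero_of_real_spectrum_eq_empty {a : ℕ} {A : Matrix (Fin a) (Fin a) ℂ}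
    (hA : IsSelfAdjoint A) (h : ∀ μ : ℝ, μ ∉ spectrum ℝ A) : A = 0 := by
  rw [← cfc_id ℝ A hA, ← cfc_zero ℝ A]
  exact cfc_congr fun x hx => absurd hx (h x)

/-- The pair `(A, B)` is a *-endomorphism of the block family `T`. -/
def IsStarEndo {m n : ℕ} {d : Fin m → ℕ} {e : Fin n → ℕ}
    (T : ∀ (l : Fin m) (k : Fin n), Matrix (Fin (d l)) (Fin (e k)) ℂ)
    (A : ∀ l : Fin m, Matrix (Fin (d l)) (Fin (d l)) ℂ)
    (B : ∀ k : Fin n, Matrix (Fin (e k)) (Fin (e k)) ℂ) : Prop :=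
  (∀ l k, A l * T l k = T l k * B k) ∧ ∀ l k, B k * (T l k)ᴴ = (T l k)ᴴ * A l

namespace IsStarEndo

variable {m n : ℕ} {d : Fin m → ℕ} {e : Fin n → ℕ}
  {T : ∀ (l : Fin m) (k : Fin n), Matrix (Fin (d l)) (Fin (e k)) ℂ}
  {A A' : ∀ l : Fin m, Matrix (Fin (d l)) (Fin (d l)) ℂ}
  {B B' : ∀ k : Fin n, Matrix (Fin (e k)) (Fin (e k)) ℂ}

theorem conjTranspose (h : IsStarEndo T A B) :
    IsStarEndo T (fun l => (A l)ᴴ) (fun k => (B k)ᴴ) := by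
  refine ⟨fun l k => ?_, fun l k => ?_⟩
  · simpa using (congrArg Matrix.conjTranspose (h.2 l k)).symm
  · simpa using (congrArg Matrix.conjTranspose (h.1 l k)).symm

theorem add (h : IsStarEndo T A B) (h' : IsStarEndo T A' B') :
    IsStarEndo T (fun l => A l + A' l) (fun k => B k + B' k) :=
  ⟨fun l k => by rw [Matrix.add_mul, Matrix.mul_add, h.1, h'.1],
    fun l k => by rw [Matrix.add_mul, Matrix.mul_add, h.2, h'.2]⟩

theorem smul (h : IsStarEndo T A B) (c : ℂ) :
    IsStarEndo T (fun l => c • A l) (fun k => c • B k) :=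
  ⟨fun l k => by rw [Matrix.smul_mul, Matrix.mul_smul, h.1],
    fun l k => by rw [Matrix.smul_mul, Matrix.mul_smul, h.2]⟩

theorem map_cfc (h : IsStarEndo T A B) (hA : ∀ l, IsSelfAdjoint (A l))
    (hB : ∀ k, IsSelfAdjoint (B k)) (f : ℝ → ℝ) :
    IsStarEndo T (fun l => cfc f (A l)) (fun k => cfc f (B k)) :=
  ⟨fun l k => cfc_mul_eq_mul_cfc (hA l) (hB k) (h.1 l k) f,
    fun l k => cfc_mul_eq_mul_cfc (hB k) (hA l) (h.2 l k) f⟩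

/-- If `T` has only trivial projections, its self-adjoint *-endomorphisms are scalar. -/
theorem exists_eq_smul_one_of_isSelfAdjoint
    (hindec : ∀ (E : ∀ l : Fin m, Matrix (Fin (d l)) (Fin (d l)) ℂ)
        (F : ∀ k : Fin n, Matrix (Fin (e k)) (Fin (e k)) ℂ),
      (∀ l, (E l)ᴴ = E l) → (∀ l, E l * E l = E l) →
      (∀ k, (F k)ᴴ = F k) → (∀ k, F k * F k = F k) →
      (∀ l k, E l * T l k = T l k * F k) →
      (∀ l k, F k * (T l k)ᴴ = (T l k)ᴴ * E l) →
      ((∀ l, E l = 0) ∧ (∀ k, F k = 0)) ∨ ((∀ l, E l = 1) ∧ (∀ k, F k = 1)))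
    (h : IsStarEndo T A B) (hA : ∀ l, IsSelfAdjoint (A l)) (hB : ∀ k, IsSelfAdjoint (B k)) :
    ∃ lam : ℂ, (∀ l, A l = lam • 1) ∧ (∀ k, B k = lam • 1) := by
  by_cases hμ : ∃ μ : ℝ, (∃ l, μ ∈ spectrum ℝ (A l)) ∨ ∃ k, μ ∈ spectrum ℝ (B k)
  · obtain ⟨μ, hμ⟩ := hμ
    have hP := h.map_cfc hA hB (Set.indicator {μ} 1)
    refine ⟨μ, ?_⟩
    obtain ⟨hE, hF⟩ | ⟨hE, hF⟩ := hindec _ _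
      (fun l => (cfc_predicate (R := ℝ) _ (A l) : IsSelfAdjoint _))
      (fun l => cfc_indicator_mul_self (A l) μ)
      (fun k => (cfc_predicate (R := ℝ) _ (B k) : IsSelfAdjoint _))
      (fun k => cfc_indicator_mul_self (B k) μ) hP.1 hP.2
    · obtain ⟨l, hl⟩ | ⟨k, hk⟩ := hμ
      · exact absurd (hE l) (cfc_indicator_ne_zero (hA l) hl)
      · exact absurd (hF k) (cfc_indicator_ne_zero (hB k) hk)
    · exact ⟨fun l => eq_smul_one_of_cfc_indicator_eq_one (hA l) (hE l),
        fun k => eq_smul_one_of_cfc_indicator_eq_one (hB k) (hF k)⟩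
  · push Not at hμ
    refine ⟨0, fun l => ?_, fun k => ?_⟩
    · rw [zero_smul]
      exact eq_zero_of_real_spectrum_eq_empty (hA l) fun μ => (hμ μ).1 l
    · rw [zero_smul]
      exact eq_zero_of_real_spectrum_eq_empty (hB k) fun μ => (hμ μ).2 k

end IsStarEndo

/-- A matrix whose doubled real and imaginary parts are scalar is scalar. -/
theorem eq_smul_one_of_add_conjTranspose {a : ℕ} {A : Matrix (Fin a) (Fin a) ℂ} {x y : ℂ}
    (hx : A + Aᴴ = x • 1) (hy : Complex.I • (A + (-1 : ℂ) • Aᴴ) = y • 1) :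
    A = ((x - Complex.I * y) / 2) • 1 := by
  have h : A = (1 / 2 : ℂ) • ((A + Aᴴ) - Complex.I • (Complex.I • (A + (-1 : ℂ) • Aᴴ))) := by
    rw [smul_smul Complex.I, Complex.I_mul_I]
    module
  rw [h, hx, hy]
  module

theorem isSelfAdjoint_I_smul_add_neg_conjTranspose {a : ℕ} (A : Matrix (Fin a) (Fin a) ℂ) :
    IsSelfAdjoint (Complex.I • (A + (-1 : ℂ) • Aᴴ)) := by
  rw [isSelfAdjoint_iff, Matrix.star_eq_conjTranspose]
  simp only [conjTranspose_smul, conjTranspose_add, conjTranspose_conjTranspose,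
    Complex.star_def, Complex.conj_I, map_neg, map_one]
  module

/-- If the only families of orthogonal projections that are *-endomorphisms of the
block family `T` are the trivial ones (all `0` or all `1`), then every
*-endomorphism `(A_l; B_k)` of `T` is scalar. -/
theorem stmt4 (m n : ℕ)
    (d : Fin m → ℕ) (e : Fin n → ℕ)
    (T : ∀ (l : Fin m) (k : Fin n), Matrix (Fin (d l)) (Fin (e k)) ℂ)
    (hindec : ∀ (E : ∀ l : Fin m, Matrix (Fin (d l)) (Fin (d l)) ℂ)
        (F : ∀ k : Fin n, Matrix (Fin (e k)) (Fin (e k)) ℂ),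
      (∀ l, (E l)ᴴ = E l) → (∀ l, E l * E l = E l) →
      (∀ k, (F k)ᴴ = F k) → (∀ k, F k * F k = F k) →
      (∀ l k, E l * T l k = T l k * F k) →
      (∀ l k, F k * (T l k)ᴴ = (T l k)ᴴ * E l) →
      ((∀ l, E l = 0) ∧ (∀ k, F k = 0)) ∨ ((∀ l, E l = 1) ∧ (∀ k, F k = 1))) :
    ∀ (A : ∀ l : Fin m, Matrix (Fin (d l)) (Fin (d l)) ℂ)
      (B : ∀ k : Fin n, Matrix (Fin (e k)) (Fin (e k)) ℂ),
      (∀ l k, A l * T l k = T l k * B k) →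
      (∀ l k, B k * (T l k)ᴴ = (T l k)ᴴ * A l) →
      ∃ lam : ℂ, (∀ l, A l = lam • 1) ∧ (∀ k, B k = lam • 1) := by
  intro A B h₁ h₂
  have h : IsStarEndo T A B := ⟨h₁, h₂⟩
  obtain ⟨x, hxA, hxB⟩ := (h.add h.conjTranspose).exists_eq_smul_one_of_isSelfAdjoint hindec
    (fun l => IsSelfAdjoint.add_star_self (A l)) (fun k => IsSelfAdjoint.add_star_self (B k))
  obtain ⟨y, hyA, hyB⟩ :=
    ((h.add (h.conjTranspose.smul (-1))).smul Complex.I).exists_eq_smul_one_of_isSelfAdjoint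
      hindec (fun l => isSelfAdjoint_I_smul_add_neg_conjTranspose (A l))
      (fun k => isSelfAdjoint_I_smul_add_neg_conjTranspose (B k))
  exact ⟨(x - Complex.I * y) / 2, fun l => eq_smul_one_of_add_conjTranspose (hxA l) (hyA l),
    fun k => eq_smul_one_of_add_conjTranspose (hxB k) (hyB k)⟩
end

section
/- Let T = (T_{lk}) be an orthoscalar matrix representation of a separated single quiver, with blocks T_{lk} of size d_l × e_k (l = 1,…,m, k = 1,…,n). Suppose T is indecomposable in the category of orthoscalar representations, i.e., whenever (E_1,…,E_m; F_1,…,F_n) is a family of orthogonal projections (self-adjoint idempotent complex matrices, E_l of size d_l, F_k of size e_k) with E_l·T_{lk} = T_{lk}·F_k and F_k·T_{lk}* = T_{lk}*·E_l for all l, k, then either all E_l = 0 and all F_k = 0, or all E_l = I and all F_k = I. Then T is a Schur representation in the category Rep Q of all representations: every family (A_1,…,A_m; B_1,…,B_n) of complex matrices (A_l of size d_l, B_k of size e_k) satisfying only A_l·T_{lk} = T_{lk}·B_k for all l, k is scalar, i.e., there exists λ ∈ ℂ with A_l = λ·I for all l and B_k = λ·I for all k. In particular, T is indecomposable in Rep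 Q. -/
open Matrix

open scoped ComplexOrder in
/-- Existence of a Moore–Penrose inverse of a square complex matrix. -/
theorem Matrix.exists_moorePenrose {ι : Type*} [Fintype ι] [DecidableEq ι]
    (M : Matrix ι ι ℂ) :
    ∃ Y : Matrix ι ι ℂ, M * Y * M = M ∧ Y * M * Y = Y ∧
      (M * Y)ᴴ = M * Y ∧ (Y * M)ᴴ = Y * M := by
  obtain ⟨K, hKH, hcomm, hHKH, hKHK⟩ : ∃ K : Matrix ι ι ℂ, Kᴴ = K ∧
      K * (Mᴴ * M) = (Mᴴ * M) * K ∧ (Mᴴ * M) * K * (Mᴴ * M) = Mᴴ * M ∧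
      K * (Mᴴ * M) * K = K := by
    have hH : (Mᴴ * M).IsHermitian := isHermitian_conjTranspose_mul_self M
    generalize Mᴴ * M = H at hH
    have hsa : IsSelfAdjoint H := hH
    have hc (f : ℝ → ℝ) : ContinuousOn f (spectrum ℝ H) := H.finite_real_spectrum.continuousOn f
    have hid : cfc (fun x : ℝ => x) H = H := cfc_id' ℝ H
    refine ⟨cfc (fun x : ℝ => x⁻¹) H, cfc_predicate (fun x : ℝ => x⁻¹) H, ?_, ?_, ?_⟩
    · nth_rewrite 2 [← hid]
      nth_rewrite 3 [← hid]
      exact cfc_commute_cfc _ _ H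
    · have h := cfc_mul (fun x : ℝ => x * x⁻¹) (fun x => x) H (hc _) (hc _)
      rw [cfc_mul (fun x : ℝ => x) (fun x => x⁻¹) H (hc _) (hc _), hid] at h
      rw [← h]
      simpa only [mul_inv_mul_cancel] using hid
    · have h := cfc_mul (fun x : ℝ => x⁻¹ * x) (fun x => x⁻¹) H (hc _) (hc _)
      rw [cfc_mul (fun x : ℝ => x⁻¹) (fun x => x) H (hc _) (hc _), hid] at h
      rw [← h]
      exact congrArg (cfc · H) (funext fun x => by simpa using mul_inv_mul_cancel x⁻¹)
  refine ⟨K * Mᴴ, ?_, ?_, ?_, ?_⟩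
  · rw [← sub_eq_zero, ← conjTranspose_mul_self_eq_zero]
    have h : (M * (K * Mᴴ) * M - M)ᴴ * (M * (K * Mᴴ) * M - M) =
        ((Mᴴ * M) * K * (Mᴴ * M)) * K * (Mᴴ * M) - (Mᴴ * M) * K * (Mᴴ * M)
          - (Mᴴ * M) * K * (Mᴴ * M) + Mᴴ * M := by
      simp only [conjTranspose_sub, conjTranspose_mul, conjTranspose_conjTranspose, hKH]
      noncomm_ring
    rw [h, hHKH, hHKH]
    simp
  · calc K * Mᴴ * M * (K * Mᴴ) = K * (Mᴴ * M) * K * Mᴴ := by simp only [Matrix.mul_assoc]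
      _ = K * Mᴴ := by rw [hKHK]
  · simp only [conjTranspose_mul, conjTranspose_conjTranspose, hKH, Matrix.mul_assoc]
  · simp only [conjTranspose_mul, conjTranspose_conjTranspose, hKH, Matrix.mul_assoc, hcomm]

/-- The squared Frobenius norm of the failure of an invariant pair of orthogonal projections
to intertwine `T`. -/
theorem Matrix.trace_intertwiner_defect {ι κ : Type*} [Fintype ι] [Fintype κ]
    {P : Matrix ι ι ℂ} {Q : Matrix κ κ ℂ} {T : Matrix ι κ ℂ}
    (hP : Pᴴ = P) (hPP : P * P = P) (hQ : Qᴴ = Q) (hQQ : Q * Q = Q)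
    (h : P * T * Q = T * Q) :
    ((P * T - T * Q) * (P * T - T * Q)ᴴ).trace =
      (P * (T * Tᴴ)).trace - (Q * (Tᴴ * T)).trace := by
  have h' : Q * Tᴴ * P = Q * Tᴴ := by
    simpa [hP, hQ, Matrix.mul_assoc] using congrArg conjTranspose h
  have e : (P * T - T * Q) * (P * T - T * Q)ᴴ = P * T * Tᴴ * P - T * Q * Tᴴ := by
    simp only [conjTranspose_sub, conjTranspose_mul, hP, hQ, Matrix.sub_mul, Matrix.mul_sub]
    have e1 : P * T * (Q * Tᴴ) = T * Q * Tᴴ := by rw [← Matrix.mul_assoc, h]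
    have e2 : T * Q * (Tᴴ * P) = T * Q * Tᴴ := by
      rw [Matrix.mul_assoc, ← Matrix.mul_assoc Q, h', Matrix.mul_assoc]
    have e3 : T * Q * (Q * Tᴴ) = T * Q * Tᴴ := by
      rw [Matrix.mul_assoc, ← Matrix.mul_assoc Q, hQQ, Matrix.mul_assoc]
    rw [e1, e2, e3]
    simp [Matrix.mul_assoc]
  have t1 : (P * T * Tᴴ * P).trace = (P * (T * Tᴴ)).trace := by
    rw [trace_mul_comm, ← Matrix.mul_assoc, ← Matrix.mul_assoc, hPP, Matrix.mul_assoc]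
  have t2 : (T * Q * Tᴴ).trace = (Q * (Tᴴ * T)).trace := by
    rw [Matrix.mul_assoc, trace_mul_comm, Matrix.mul_assoc]
  rw [e, trace_sub, t1, t2]

section Orthoscalar

variable {m n : ℕ} {d : Fin m → ℕ} {e : Fin n → ℕ}
  {T : ∀ (l : Fin m) (k : Fin n), Matrix (Fin (d l)) (Fin (e k)) ℂ}
  {χ : Fin m → ℝ} {χ' : Fin n → ℝ}

/-- The defect of a subrepresentation of an orthoscalar representation equals its weighted
dimension. -/
theorem sum_trace_intertwiner_defect
    (hrow : ∀ l, ∑ k, T l k * (T l k)ᴴ = (χ l : ℂ) • (1 : Matrix (Fin (d l)) (Fin (d l)) ℂ))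
    (hcol : ∀ k, ∑ l, (T l k)ᴴ * T l k = (χ' k : ℂ) • (1 : Matrix (Fin (e k)) (Fin (e k)) ℂ))
    {P : ∀ l : Fin m, Matrix (Fin (d l)) (Fin (d l)) ℂ}
    {Q : ∀ k : Fin n, Matrix (Fin (e k)) (Fin (e k)) ℂ}
    (hP : ∀ l, (P l)ᴴ = P l) (hPP : ∀ l, P l * P l = P l)
    (hQ : ∀ k, (Q k)ᴴ = Q k) (hQQ : ∀ k, Q k * Q k = Q k)
    (h : ∀ l k, P l * T l k * Q k = T l k * Q k) :
    ∑ l, ∑ k, ((P l * T l k - T l k * Q k) * (P l * T l k - T l k * Q k)ᴴ).trace =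
      ∑ l, χ l * (P l).trace - ∑ k, χ' k * (Q k).trace := by
  simp_rw [fun l k => trace_intertwiner_defect (hP l) (hPP l) (hQ k) (hQQ k) (h l k),
    Finset.sum_sub_distrib]
  congr 1
  · refine Finset.sum_congr rfl fun l _ => ?_
    rw [← trace_sum, ← Matrix.mul_sum, hrow]
    simp
  · rw [Finset.sum_comm]
    refine Finset.sum_congr rfl fun k _ => ?_
    rw [← trace_sum, ← Matrix.mul_sum, hcol]
    simp

open scoped ComplexOrder in
/-- The orthogonal projections `1 - Y * A`, `1 - Z * B` onto the kernels of an endomorphism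
`(A, B)` of an orthoscalar representation, with Moore–Penrose inverses `(Y, Z)`, intertwine `T`. -/
theorem kernel_projection_intertwines
    (hrow : ∀ l, ∑ k, T l k * (T l k)ᴴ = (χ l : ℂ) • (1 : Matrix (Fin (d l)) (Fin (d l)) ℂ))
    (hcol : ∀ k, ∑ l, (T l k)ᴴ * T l k = (χ' k : ℂ) • (1 : Matrix (Fin (e k)) (Fin (e k)) ℂ))
    {A Y : ∀ l : Fin m, Matrix (Fin (d l)) (Fin (d l)) ℂ}
    {B Z : ∀ k : Fin n, Matrix (Fin (e k)) (Fin (e k)) ℂ}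
    (hAYA : ∀ l, A l * Y l * A l = A l) (hYAY : ∀ l, Y l * A l * Y l = Y l)
    (hAY : ∀ l, (A l * Y l)ᴴ = A l * Y l) (hYA : ∀ l, (Y l * A l)ᴴ = Y l * A l)
    (hBZB : ∀ k, B k * Z k * B k = B k) (hZBZ : ∀ k, Z k * B k * Z k = Z k)
    (hBZ : ∀ k, (B k * Z k)ᴴ = B k * Z k) (hZB : ∀ k, (Z k * B k)ᴴ = Z k * B k)
    (hAB : ∀ l k, A l * T l k = T l k * B k) (l : Fin m) (k : Fin n) :
    (1 - Y l * A l) * T l k = T l k * (1 - Z k * B k) := by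
  have iYA (l) : Y l * A l * (Y l * A l) = Y l * A l := by rw [← Matrix.mul_assoc, hYAY]
  have iZB (k) : Z k * B k * (Z k * B k) = Z k * B k := by rw [← Matrix.mul_assoc, hZBZ]
  have hker := sum_trace_intertwiner_defect hrow hcol
    (P := fun l => 1 - Y l * A l) (Q := fun k => 1 - Z k * B k)
    (fun l => by simp only [conjTranspose_sub, conjTranspose_one, hYA])
    (fun l => IsIdempotentElem.one_sub (iYA l))
    (fun k => by simp only [conjTranspose_sub, conjTranspose_one, hZB])
    (fun k => IsIdempotentElem.one_sub (iZB k))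
    (fun l k => by
      have h0 : A l * T l k * (1 - Z k * B k) = 0 := by
        rw [hAB, Matrix.mul_sub, Matrix.mul_one, Matrix.mul_assoc, ← Matrix.mul_assoc (B k), hBZB,
          sub_self]
      rw [Matrix.sub_mul, Matrix.one_mul, Matrix.sub_mul, Matrix.mul_assoc (Y l),
        Matrix.mul_assoc (Y l), h0, Matrix.mul_zero, sub_zero])
  have hran := sum_trace_intertwiner_defect hrow hcol
    (P := fun l => A l * Y l) (Q := fun k => B k * Z k) hAY
    (fun l => by rw [← Matrix.mul_assoc, hAYA]) hBZ
    (fun k => by rw [← Matrix.mul_assoc, hBZB])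
    (fun l k => by
      have h0 : T l k * (B k * Z k) = A l * T l k * Z k := by rw [← Matrix.mul_assoc, hAB]
      rw [Matrix.mul_assoc _ (T l k), h0, ← Matrix.mul_assoc, ← Matrix.mul_assoc, hAYA])
  have hone := sum_trace_intertwiner_defect hrow hcol (P := fun _ => 1) (Q := fun _ => 1)
    (by simp) (by simp) (by simp) (by simp) (by simp)
  simp only [Matrix.one_mul, Matrix.mul_one, sub_self, Matrix.zero_mul, trace_zero,
    Finset.sum_const_zero] at hone
  simp only [trace_sub, mul_sub, Finset.sum_sub_distrib] at hker
  simp only [trace_mul_comm (A _), trace_mul_comm (B _)] at hran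
  have hpos {ι κ : Type} [Fintype ι] [Fintype κ] (D : Matrix ι κ ℂ) : 0 ≤ (D * Dᴴ).trace :=
    (posSemidef_self_mul_conjTranspose D).trace_nonneg
  have hzero := le_antisymm
    (le_of_le_of_eq (le_add_of_nonneg_right
        (Finset.sum_nonneg fun l _ => Finset.sum_nonneg fun k _ => hpos
          (A l * Y l * T l k - T l k * (B k * Z k))))
      (by rw [hker, hran]; linear_combination -hone))
    (Finset.sum_nonneg fun l _ => Finset.sum_nonneg fun k _ => hpos
      ((1 - Y l * A l) * T l k - T l k * (1 - Z k * B k)))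
  rw [Finset.sum_eq_zero_iff_of_nonneg fun l _ => Finset.sum_nonneg fun k _ => hpos _] at hzero
  have hzero := hzero l (Finset.mem_univ l)
  rw [Finset.sum_eq_zero_iff_of_nonneg fun k _ => hpos _] at hzero
  exact sub_eq_zero.mp (trace_mul_conjTranspose_self_eq_zero_iff.mp (hzero k (Finset.mem_univ k)))

end Orthoscalar


/-- Main theorem: an orthoscalar matrix representation `T` of a separated single quiver
which is indecomposable in the category of orthoscalar representations is a Schur
representation in `Rep Q`: every family `(A_l; B_k)` with `A_l T_{lk} = T_{lk} B_k`
for all `l, k` is scalar. In particular `T` is indecomposable in `Rep Q`. -/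
theorem stmt5 (m n : ℕ) (hm : 0 < m) (hn : 0 < n)
    (d : Fin m → ℕ) (e : Fin n → ℕ)
    (hd : ∀ l, 0 < d l) (he : ∀ k, 0 < e k)
    (T : ∀ (l : Fin m) (k : Fin n), Matrix (Fin (d l)) (Fin (e k)) ℂ)
    (χ : Fin m → ℝ) (χ' : Fin n → ℝ)
    (hχ : ∀ l, 0 < χ l) (hχ' : ∀ k, 0 < χ' k)
    (hrow : ∀ l, ∑ k, T l k * (T l k)ᴴ = (χ l : ℂ) • (1 : Matrix (Fin (d l)) (Fin (d l)) ℂ))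
    (hcol : ∀ k, ∑ l, (T l k)ᴴ * T l k = (χ' k : ℂ) • (1 : Matrix (Fin (e k)) (Fin (e k)) ℂ))
    (hindec : ∀ (E : ∀ l : Fin m, Matrix (Fin (d l)) (Fin (d l)) ℂ)
        (F : ∀ k : Fin n, Matrix (Fin (e k)) (Fin (e k)) ℂ),
      (∀ l, (E l)ᴴ = E l) → (∀ l, E l * E l = E l) →
      (∀ k, (F k)ᴴ = F k) → (∀ k, F k * F k = F k) →
      (∀ l k, E l * T l k = T l k * F k) →
      (∀ l k, F k * (T l k)ᴴ = (T l k)ᴴ * E l) →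
      ((∀ l, E l = 0) ∧ (∀ k, F k = 0)) ∨ ((∀ l, E l = 1) ∧ (∀ k, F k = 1))) :
    ∀ (A : ∀ l : Fin m, Matrix (Fin (d l)) (Fin (d l)) ℂ)
      (B : ∀ k : Fin n, Matrix (Fin (e k)) (Fin (e k)) ℂ),
      (∀ l k, A l * T l k = T l k * B k) →
      ∃ lam : ℂ, (∀ l, A l = lam • 1) ∧ (∀ k, B k = lam • 1) := by
  intro A B hAB
  obtain ⟨lam, hlam⟩ : (spectrum ℂ (A ⟨0, hm⟩)).Nonempty := by
    have : Nonempty (Fin (d ⟨0, hm⟩)) := ⟨⟨0, hd _⟩⟩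
    exact spectrum.nonempty_of_isAlgClosed_of_finiteDimensional ℂ _
  rw [spectrum.mem_iff, Algebra.algebraMap_eq_smul_one] at hlam
  choose Y hAYA hYAY hAY hYA using fun l => exists_moorePenrose (lam • 1 - A l)
  choose Z hBZB hZBZ hBZ hZB using fun k => exists_moorePenrose (lam • 1 - B k)
  have hint := kernel_projection_intertwines hrow hcol hAYA hYAY hAY hYA hBZB hZBZ hBZ hZB
    (fun l k => by simp [Matrix.sub_mul, Matrix.mul_sub, hAB])
  have sYA (l) : (1 - Y l * (lam • 1 - A l))ᴴ = 1 - Y l * (lam • 1 - A l) := by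
    rw [conjTranspose_sub, conjTranspose_one, hYA]
  have sZB (k) : (1 - Z k * (lam • 1 - B k))ᴴ = 1 - Z k * (lam • 1 - B k) := by
    rw [conjTranspose_sub, conjTranspose_one, hZB]
  rcases hindec _ _ sYA
    (fun l => IsIdempotentElem.one_sub
      (show _ * _ = _ by rw [← Matrix.mul_assoc, hYAY])) sZB
    (fun k => IsIdempotentElem.one_sub
      (show _ * _ = _ by rw [← Matrix.mul_assoc, hZBZ])) hint
    (fun l k => by
      have h := congrArg conjTranspose (hint l k)
      rw [conjTranspose_mul, conjTranspose_mul, sYA, sZB] at h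
      exact h.symm) with ⟨h, -⟩ | ⟨hE, hF⟩
  · exact absurd (IsUnit.of_mul_eq_one_right _ (sub_eq_zero.mp (h ⟨0, hm⟩)).symm) hlam
  · refine ⟨lam, fun l => ?_, fun k => ?_⟩
    · have h := hAYA l
      rw [Matrix.mul_assoc, sub_eq_self.mp (hE l), Matrix.mul_zero] at h
      exact (sub_eq_zero.mp h.symm).symm
    · have h := hBZB k
      rw [Matrix.mul_assoc, sub_eq_self.mp (hF k), Matrix.mul_zero] at h
      exact (sub_eq_zero.mp h.symm).symm
end

section
/- Let H be a finite-dimensional complex inner product space, let P_1,…,P_n be orthogonal projections on H (self-adjoint idempotent linear operators), and let α_1,…,α_n be positive real numbers with Σ_{i=1}^n α_i·P_i = id_H (the orthoscalarity condition). Suppose the system is indecomposable: every orthogonal projection E on H satisfying E·P_i = P_i·E for all i = 1,…,n equals 0 or id_H. Then every linear operator C on H satisfying C·P_i = P_i·C·P_i for all i = 1,…,n is a scalar multiple of the identity. -/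
/-- An operator `B` on a finite-dimensional complex inner product space vanishes
as soon as the trace of `B* B` has nonpositive real part. -/
theorem eq_zero_of_re_trace_adjoint_mul_self_nonpos {H : Type*} [NormedAddCommGroup H]
    [InnerProductSpace ℂ H] [FiniteDimensional ℂ H] (B : H →ₗ[ℂ] H)
    (h : (LinearMap.trace ℂ H (LinearMap.adjoint B * B)).re ≤ 0) : B = 0 := by
  rw [LinearMap.trace_eq_sum_inner _ (stdOrthonormalBasis ℂ H), Complex.re_sum] at h
  have hterm : ∀ v : H, (inner ℂ v ((LinearMap.adjoint B * B) v)).re = ‖B v‖ ^ 2 := fun v => by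
    rw [Module.End.mul_apply, LinearMap.adjoint_inner_right]
    exact inner_self_eq_norm_sq (𝕜 := ℂ) (B v)
  simp only [hterm] at h
  have hz := (Finset.sum_eq_zero_iff_of_nonneg fun i _ => sq_nonneg _).1
    (le_antisymm h (Finset.sum_nonneg fun i _ => sq_nonneg _))
  refine (stdOrthonormalBasis ℂ H).toBasis.ext fun i => ?_
  simpa using hz i (Finset.mem_univ i)

/-- The real part of `trace ℂ H (B* B)` is nonnegative. -/
theorem re_trace_adjoint_mul_self_nonneg {H : Type*} [NormedAddCommGroup H]
    [InnerProductSpace ℂ H] [FiniteDimensional ℂ H] (B : H →ₗ[ℂ] H) :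
    0 ≤ (LinearMap.trace ℂ H (LinearMap.adjoint B * B)).re := by
  rw [LinearMap.trace_eq_sum_inner _ (stdOrthonormalBasis ℂ H), Complex.re_sum]
  refine Finset.sum_nonneg fun i _ => ?_
  rw [Module.End.mul_apply, LinearMap.adjoint_inner_right]
  exact inner_self_nonneg (𝕜 := ℂ)

/-- An endomorphism of an orthoscalar system of projections commutes with every projection. -/
theorem commute_of_orthoscalar {ι H : Type*} [Fintype ι] [NormedAddCommGroup H]
    [InnerProductSpace ℂ H] [FiniteDimensional ℂ H] (P : ι → Module.End ℂ H)
    (hsa : ∀ i, LinearMap.adjoint (P i) = P i) (hidem : ∀ i, P i * P i = P i)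
    (α : ι → ℝ) (hα : ∀ i, 0 < α i) (hortho : ∑ i, (α i : ℂ) • P i = 1)
    (C : Module.End ℂ H) (hC : ∀ i, C * P i = P i * C * P i) (i : ι) : Commute C (P i) := by
  set B : ι → Module.End ℂ H := fun i => P i * C * (1 - P i) with hB
  have hBcomm : ∀ i, B i = P i * C - C * P i := fun i => by
    rw [hC i, hB]; simp only [mul_sub, mul_one]
  have hsum : ∑ i, (α i : ℂ) • B i = 0 := by
    have hl : ∑ i, (α i : ℂ) • (P i * C) = C := by
      simp only [← smul_mul_assoc, ← Finset.sum_mul, hortho, one_mul]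
    have hr : ∑ i, (α i : ℂ) • (C * P i) = C := by
      simp only [← mul_smul_comm, ← Finset.mul_sum, hortho, mul_one]
    simp only [hBcomm, smul_sub, Finset.sum_sub_distrib, hl, hr, sub_self]
  have htr : ∀ i, LinearMap.trace ℂ H (LinearMap.adjoint C * B i) =
      LinearMap.trace ℂ H (LinearMap.adjoint (B i) * B i) := fun i => by
    have hQ : (1 - P i) * (1 - P i) = 1 - P i := IsIdempotentElem.one_sub (hidem i)
    have hadj : LinearMap.adjoint (B i) = (1 - P i) * LinearMap.adjoint C * P i := by
      have hs : star (P i) = P i := hsa i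
      change star (B i) = (1 - P i) * star C * P i
      simp only [hB, star_mul, star_sub, star_one, hs, mul_assoc]
    calc LinearMap.trace ℂ H (LinearMap.adjoint C * B i)
        = LinearMap.trace ℂ H ((LinearMap.adjoint C * P i * C * (1 - P i)) * (1 - P i)) := by
          rw [mul_assoc _ (1 - P i), hQ, hB]; simp only [mul_assoc]
      _ = LinearMap.trace ℂ H ((1 - P i) * (LinearMap.adjoint C * P i * C * (1 - P i))) :=
          LinearMap.trace_mul_comm ℂ _ _
      _ = LinearMap.trace ℂ H ((1 - P i) * (LinearMap.adjoint C * (P i * P i) * C * (1 - P i))) := by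
          rw [hidem i]
      _ = _ := by rw [hadj, hB]; simp only [mul_assoc]
  have hzero : ∑ i, α i * (LinearMap.trace ℂ H (LinearMap.adjoint (B i) * B i)).re = 0 := by
    have := congrArg (fun T => (LinearMap.trace ℂ H (LinearMap.adjoint C * T)).re) hsum
    simpa [Finset.mul_sum, mul_smul_comm, htr] using this
  have hi := (Finset.sum_eq_zero_iff_of_nonneg fun j _ =>
    mul_nonneg (hα j).le (re_trace_adjoint_mul_self_nonneg (B j))).1 hzero i (Finset.mem_univ i)
  have hBi := eq_zero_of_re_trace_adjoint_mul_self_nonpos (B i)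
    ((mul_eq_zero.1 hi).resolve_left (hα i).ne').le
  rw [hBcomm, sub_eq_zero] at hBi
  exact hBi.symm

/-- The orthogonal projection onto a subspace invariant under a self-adjoint operator
commutes with that operator. -/
theorem starProjection_comp_comm {H : Type*} [NormedAddCommGroup H]
    [InnerProductSpace ℂ H] [FiniteDimensional ℂ H] (K : Submodule ℂ H) (T : H →ₗ[ℂ] H)
    (hT : LinearMap.adjoint T = T) (hK : ∀ x ∈ K, T x ∈ K) :
    (K.starProjection : H →ₗ[ℂ] H) ∘ₗ T = T ∘ₗ (K.starProjection : H →ₗ[ℂ] H) := by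
  ext x
  refine Submodule.eq_starProjection_of_mem_of_inner_eq_zero
    (hK _ (K.starProjection_apply_mem x)) fun w hw => ?_
  change inner ℂ (T x - T (K.starProjection x)) w = 0
  rw [← map_sub, ← LinearMap.adjoint_inner_right, hT]
  exact K.starProjection_inner_eq_zero x _ (hK w hw)


/-- An indecomposable orthoscalar system of `n` orthogonal projections on a
finite-dimensional Hilbert space is a Schur object in the category `K(P_n)`:
every operator `C` with `C P_i = P_i C P_i` for all `i` is scalar. -/
theorem stmt6 (n : ℕ) (H : Type*) [NormedAddCommGroup H] [InnerProductSpace ℂ H]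
    [FiniteDimensional ℂ H]
    (P : Fin n → (H →ₗ[ℂ] H))
    (hsa : ∀ i, LinearMap.adjoint (P i) = P i)
    (hidem : ∀ i, P i ∘ₗ P i = P i)
    (α : Fin n → ℝ) (hα : ∀ i, 0 < α i)
    (hortho : ∑ i, (α i : ℂ) • P i = LinearMap.id)
    (hindec : ∀ E : H →ₗ[ℂ] H, LinearMap.adjoint E = E → E ∘ₗ E = E →
      (∀ i, E ∘ₗ P i = P i ∘ₗ E) → E = 0 ∨ E = LinearMap.id) :
    ∀ C : H →ₗ[ℂ] H, (∀ i, C ∘ₗ P i = P i ∘ₗ C ∘ₗ P i) →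
      ∃ lam : ℂ, C = lam • LinearMap.id := by
  intro C hC
  rcases subsingleton_or_nontrivial H with _ | _
  · exact ⟨0, Subsingleton.elim _ _⟩
  have hcomm : ∀ i, Commute C (P i) := commute_of_orthoscalar P hsa hidem α hα hortho C hC
  obtain ⟨μ, hμ⟩ := Module.End.exists_eigenvalue C
  have hinv : ∀ i, ∀ x ∈ Module.End.eigenspace C μ, P i x ∈ Module.End.eigenspace C μ := by
    intro i x hx
    rw [Module.End.mem_eigenspace_iff] at hx ⊢
    rw [← Module.End.mul_apply, (hcomm i).eq, Module.End.mul_apply, hx, map_smul]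
  set K := Module.End.eigenspace C μ
  refine ⟨μ, ?_⟩
  have hE := hindec (K.starProjection : H →ₗ[ℂ] H)
    (LinearMap.isSelfAdjoint_iff'.1
      ((LinearMap.isSymmetric_iff_isSelfAdjoint _).1 K.starProjection_isSymmetric))
    (by ext x; exact K.starProjection_eq_self_iff.2 (K.starProjection_apply_mem x))
    (fun i => starProjection_comp_comm K (P i) (hsa i) (hinv i))
  rcases hE with h0 | h1
  · obtain ⟨v, hv⟩ := hμ.exists_hasEigenvector
    refine absurd ?_ hv.2
    rw [← K.starProjection_eq_self_iff.2 hv.1]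
    exact LinearMap.congr_fun h0 v
  · ext x
    exact Module.End.mem_eigenspace_iff.1
      (K.starProjection_eq_self_iff.1 (LinearMap.congr_fun h1 x))
end

section
/- Let H_0, H̃_0 and H_1,…,H_n, H̃_1,…,H̃_n be finite-dimensional complex inner product spaces, and for each i let Γ_i : H_i → H_0 and Γ̃_i : H̃_i → H̃_0 be linear maps with Γ_i*·Γ_i = id_{H_i} and Γ̃_i*·Γ̃_i = id_{H̃_i} (isometries), and set P_i = Γ_i·Γ_i* and P̃_i = Γ̃_i·Γ̃_i* (orthogonal projections). Then for a linear map C_0 : H_0 → H̃_0 the following are equivalent: (1) C_0·P_i = P̃_i·C_0·P_i for all i = 1,…,n; (2) there exist linear maps C_i : H_i → H̃_i with C_0·Γ_i = Γ̃_i·C_i for all i = 1,…,n. Moreover, when they exist, the maps C_i are uniquely determined: C_i = Γ̃_i*·C_0·Γ_i. -/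
/-- Key computation for the equivalence `K(Q_n) ≃ K(P_n)`: given isometries
`Γ_i : H_i → H_0`, `Γ̃_i : H̃_i → H̃_0` with associated orthogonal projections
`P_i = Γ_i Γ_i*`, `P̃_i = Γ̃_i Γ̃_i*`, a map `C_0 : H_0 → H̃_0` satisfies
`C_0 P_i = P̃_i C_0 P_i` for all `i` iff it lifts through the isometries
(`C_0 Γ_i = Γ̃_i C_i`), and the lifts `C_i` are unique, given by `Γ̃_i* C_0 Γ_i`. -/
theorem stmt8 (n : ℕ)
    (H0 H0' : Type*) [NormedAddCommGroup H0] [InnerProductSpace ℂ H0]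
    [FiniteDimensional ℂ H0] [NormedAddCommGroup H0'] [InnerProductSpace ℂ H0']
    [FiniteDimensional ℂ H0']
    (H : Fin n → Type*) [∀ i, NormedAddCommGroup (H i)] [∀ i, InnerProductSpace ℂ (H i)]
    [∀ i, FiniteDimensional ℂ (H i)]
    (H' : Fin n → Type*) [∀ i, NormedAddCommGroup (H' i)] [∀ i, InnerProductSpace ℂ (H' i)]
    [∀ i, FiniteDimensional ℂ (H' i)]
    (Γ : ∀ i, H i →ₗ[ℂ] H0) (Γ' : ∀ i, H' i →ₗ[ℂ] H0')
    (hΓ : ∀ i, LinearMap.adjoint (Γ i) ∘ₗ Γ i = LinearMap.id)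
    (hΓ' : ∀ i, LinearMap.adjoint (Γ' i) ∘ₗ Γ' i = LinearMap.id)
    (P : Fin n → (H0 →ₗ[ℂ] H0)) (hP : ∀ i, P i = Γ i ∘ₗ LinearMap.adjoint (Γ i))
    (P' : Fin n → (H0' →ₗ[ℂ] H0')) (hP' : ∀ i, P' i = Γ' i ∘ₗ LinearMap.adjoint (Γ' i))
    (C0 : H0 →ₗ[ℂ] H0') :
    ((∀ i, C0 ∘ₗ P i = P' i ∘ₗ C0 ∘ₗ P i) ↔
      (∃ C : ∀ i, H i →ₗ[ℂ] H' i, ∀ i, C0 ∘ₗ Γ i = Γ' i ∘ₗ C i)) ∧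
    (∀ C : ∀ i, H i →ₗ[ℂ] H' i, (∀ i, C0 ∘ₗ Γ i = Γ' i ∘ₗ C i) →
      ∀ i, C i = LinearMap.adjoint (Γ' i) ∘ₗ C0 ∘ₗ Γ i) := by
  have hΓ_apply (i) (x : H i) : LinearMap.adjoint (Γ i) (Γ i x) = x :=
    LinearMap.congr_fun (hΓ i) x
  have hΓ'_apply (i) (x : H' i) : LinearMap.adjoint (Γ' i) (Γ' i x) = x :=
    LinearMap.congr_fun (hΓ' i) x
  refine ⟨⟨fun h => ⟨fun i => LinearMap.adjoint (Γ' i) ∘ₗ C0 ∘ₗ Γ i, fun i => ?_⟩, ?_⟩, ?_⟩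
  · ext x
    simpa [hP, hP', hΓ_apply] using LinearMap.congr_fun (h i) (Γ i x)
  · rintro ⟨C, hC⟩ i
    have hC_apply (x : H i) : C0 (Γ i x) = Γ' i (C i x) := LinearMap.congr_fun (hC i) x
    ext x
    simp [hP, hP', hC_apply, hΓ'_apply]
  · intro C hC i
    rw [hC i, ← LinearMap.comp_assoc, hΓ' i, LinearMap.id_comp]
end

section
/- Let T be the 2×2 complex matrix with rows (1, 1) and (0, −1), and let A be the 2×2 complex matrix with rows (3, 1) and (0, 1). Then: (i) T·T* + T*·T = 3·I (so T is an orthoscalar representation of the one-loop quiver); (ii) every 2×2 complex matrix C satisfying C·T = T·C and C·T* = T*·C is a scalar multiple of I (so T is indecomposable as an orthoscalar representation); (iii) A is invertible, A is not a scalar multiple of I, and A·T = T·A (so T admits a nonscalar invertible endomorphism, hence is decomposable, in the category Rep Q of all representations of the loop quiver). -/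
open Matrix

/-- Counterexample for the non-separated (loop) quiver: the matrix
`T = [[1,1],[0,-1]]` satisfies the orthoscalarity condition `T Tᴴ + Tᴴ T = 3 I`,
is indecomposable as an orthoscalar representation (every `C` commuting with both
`T` and `Tᴴ` is scalar), yet `A = [[3,1],[0,1]]` is an invertible nonscalar matrix
commuting with `T`, so `T` is decomposable in `Rep Q`. -/
theorem stmt9 (T A : Matrix (Fin 2) (Fin 2) ℂ)
    (hT : T = !![1, 1; 0, -1]) (hA : A = !![3, 1; 0, 1]) :
    (T * Tᴴ + Tᴴ * T = (3 : ℂ) • (1 : Matrix (Fin 2) (Fin 2) ℂ)) ∧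
    (∀ C : Matrix (Fin 2) (Fin 2) ℂ, C * T = T * C → C * Tᴴ = Tᴴ * C →
      ∃ lam : ℂ, C = lam • (1 : Matrix (Fin 2) (Fin 2) ℂ)) ∧
    (IsUnit A ∧ (¬ ∃ lam : ℂ, A = lam • (1 : Matrix (Fin 2) (Fin 2) ℂ)) ∧
      A * T = T * A) := by
  subst hT hA
  have hTH : (!![1, 1; 0, -1] : Matrix (Fin 2) (Fin 2) ℂ)ᴴ = !![1, 0; 1, -1] := by
    ext i j
    fin_cases i <;> fin_cases j <;> simp
  rw [hTH]
  refine ⟨?_, fun C hC hCH => ⟨C 0 0, ?_⟩, ?_, ?_, ?_⟩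
  · ext i j
    fin_cases i <;> fin_cases j <;> norm_num [Matrix.mul_apply, Fin.sum_univ_two]
  · have h₁ := congrFun (congrFun hC 0) 0
    have h₂ := congrFun (congrFun hC 0) 1
    have h₃ := congrFun (congrFun hCH 0) 0
    simp [Matrix.mul_apply, Fin.sum_univ_two] at h₁ h₂ h₃
    ext i j
    fin_cases i <;> fin_cases j <;> simp <;> grind
  · rw [Matrix.isUnit_iff_isUnit_det]
    simp [Matrix.det_fin_two]
  · rintro ⟨c, hc⟩
    simpa using congrFun (congrFun hc 0) 1
  · ext i j
    fin_cases i <;> fin_cases j <;> norm_num [Matrix.mul_apply, Fin.sum_univ_two]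
end
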